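/- Let (T_m)_{m : ℕ} be a sequence of trees and let G be the disjoint union of the graphs G_{T_m}(m) over all m : ℕ. Then for every n : ℕ, there exists an injective graph homomorphism from H_n into G if and only if T_n has an infinite path. -/

import Mathlib

/-- A tree: a set of finite sequences of naturals closed under initial segments. -/
def IsTree (T : Set (List ℕ)) : Prop :=
  ∀ ⦃σ τ : List ℕ⦄, τ ∈ T → σ <+: τ → σ ∈ T

/-- Base relation of `H_n`: a triangle on `Fin 3` with designated vertex `t₀ = inl 0`;
for each `k : ℕ` a `(2n+4)`-cycle block `D_k` on `ZMod (2n+4)` (with `v⁰ = 0` and its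
antipode `v¹ = n+2`); an edge from `t₀` to the `v⁰` of `D_0`; and an edge from the `v¹` of
`D_k` to the `v⁰` of `D_{k+1}`. -/
def relH (n : ℕ) : Fin 3 ⊕ ℕ × ZMod (2 * n + 4) → Fin 3 ⊕ ℕ × ZMod (2 * n + 4) → Prop
  | Sum.inl _, Sum.inl _ => True
  | Sum.inl i, Sum.inr (k, x) => i = 0 ∧ k = 0 ∧ x = 0
  | Sum.inr (k, x), Sum.inr (k', x') =>
      (k' = k ∧ x' = x + 1) ∨
      (k' = k + 1 ∧ x = (n + 2 : ZMod (2 * n + 4)) ∧ x' = 0)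
  | _, _ => False

/-- The graph `H_n`: an infinite chain of `(2n+4)`-cycle blocks with a triangle at one end. -/
def Hn (n : ℕ) : SimpleGraph (Fin 3 ⊕ ℕ × ZMod (2 * n + 4)) :=
  SimpleGraph.fromRel (relH n)

/-- Vertices of `G_T(n)`: a triangle on `Fin 3` (with `t₀ = inl 0`) together with a
`(2n+4)`-cycle block `C_σ` for each nonempty `σ ∈ T`. -/
def VG (T : Set (List ℕ)) (n : ℕ) : Type :=
  Fin 3 ⊕ ({σ : List ℕ // σ ∈ T ∧ σ ≠ []} × ZMod (2 * n + 4))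

/-- Base relation of `G_T(n)`: the triangle; the cycle edges of each block `C_σ` (with
`v⁰ = 0` and its antipode `v¹ = n+2`); an edge from `t₀` to the `v⁰` of `C_σ` for each
`σ ∈ T` of length `1`; and an edge from the `v¹` of `C_σ` to the `v⁰` of `C_τ` whenever
`τ = σ ++ [m]` for some `m`. -/
def relG (T : Set (List ℕ)) (n : ℕ) : VG T n → VG T n → Prop
  | Sum.inl _, Sum.inl _ => True
  | Sum.inl i, Sum.inr (σ, x) => i = 0 ∧ σ.1.length = 1 ∧ x = 0
  | Sum.inr (σ, x), Sum.inr (τ, y) =>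
      (σ = τ ∧ y = x + 1) ∨
      (x = (n + 2 : ZMod (2 * n + 4)) ∧ y = 0 ∧ ∃ m : ℕ, τ.1 = σ.1 ++ [m])
  | _, _ => False

/-- The graph `G_T(n)`. -/
def Gn (T : Set (List ℕ)) (n : ℕ) : SimpleGraph (VG T n) :=
  SimpleGraph.fromRel (relG T n)


/-- Vertices of the disjoint union of the graphs `G_{T m}(m)` over `m : ℕ`. -/
def VU (T : ℕ → Set (List ℕ)) : Type := Σ m : ℕ, VG (T m) m

/-- Base relation of the disjoint union: vertices in the same summand adjacent there. -/
def relU (T : ℕ → Set (List ℕ)) : VU T → VU T → Prop :=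
  fun a b => ∃ h : a.1 = b.1, (Gn (T b.1) b.1).Adj (cast (by rw [h]) a.2) b.2

/-- The disjoint union of the graphs `G_{T m}(m)` over `m : ℕ`. -/
def GU (T : ℕ → Set (List ℕ)) : SimpleGraph (VU T) :=
  SimpleGraph.fromRel (relU T)

lemma zmod_one_ne_zero (m : ℕ) : (1 : ZMod (2 * m + 4)) ≠ 0 := by
  have : Fact (1 < 2 * m + 4) := ⟨by omega⟩
  exact one_ne_zero

lemma zmod_antipode_ne_zero (m : ℕ) : (m + 2 : ZMod (2 * m + 4)) ≠ 0 := by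
  intro h
  have h' : ((m + 2 : ℕ) : ZMod (2 * m + 4)) = 0 := by push_cast; exact h
  rw [ZMod.natCast_eq_zero_iff] at h'
  have := Nat.le_of_dvd (by omega) h'
  omega

lemma zmod_neg_antipode (m : ℕ) : -(m + 2 : ZMod (2 * m + 4)) = m + 2 := by
  have h : ((2 * m + 4 : ℕ) : ZMod (2 * m + 4)) = 0 := ZMod.natCast_self _
  push_cast at h
  linear_combination -h

lemma Gn_adj {T : Set (List ℕ)} {m : ℕ} {a b : VG T m} :
    (Gn T m).Adj a b ↔ a ≠ b ∧ (relG T m a b ∨ relG T m b a) :=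
  SimpleGraph.fromRel_adj _ _ _

lemma GU_adj {T : ℕ → Set (List ℕ)} {a b : VU T} :
    (GU T).Adj a b ↔ a ≠ b ∧ (relU T a b ∨ relU T b a) :=
  SimpleGraph.fromRel_adj _ _ _

/-- The neighbours in `G_T(m)` of a block vertex. -/
lemma Gn_adj_inr {T : Set (List ℕ)} {m : ℕ} {σ : {σ : List ℕ // σ ∈ T ∧ σ ≠ []}}
    {y : ZMod (2 * m + 4)} {w : VG T m} (h : (Gn T m).Adj (Sum.inr (σ, y)) w) :
    (∃ y', w = Sum.inr (σ, y') ∧ (y' = y + 1 ∨ y' = y - 1)) ∨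
    (y = 0 ∧ ((w = Sum.inl 0 ∧ σ.1.length = 1) ∨
      ∃ ρ : {σ : List ℕ // σ ∈ T ∧ σ ≠ []}, w = Sum.inr (ρ, (m + 2 : ZMod (2 * m + 4))) ∧
        ∃ j : ℕ, σ.1 = ρ.1 ++ [j])) ∨
    (y = m + 2 ∧ ∃ τ : {σ : List ℕ // σ ∈ T ∧ σ ≠ []}, w = Sum.inr (τ, (0 : ZMod (2 * m + 4))) ∧
        ∃ j : ℕ, τ.1 = σ.1 ++ [j]) := by
  obtain ⟨-, h⟩ := Gn_adj.1 h
  rcases w with i | ⟨τ, z⟩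
  · rcases h with h | h
    · exact h.elim
    · obtain ⟨rfl, h1, rfl⟩ := h
      exact Or.inr (Or.inl ⟨rfl, Or.inl ⟨rfl, h1⟩⟩)
  · rcases h with (⟨rfl, rfl⟩ | ⟨rfl, rfl, h1⟩) | (⟨rfl, rfl⟩ | ⟨rfl, rfl, h1⟩)
    · exact Or.inl ⟨_, rfl, Or.inl rfl⟩
    · exact Or.inr (Or.inr ⟨rfl, τ, rfl, h1⟩)
    · exact Or.inl ⟨_, rfl, Or.inr (by ring)⟩
    · exact Or.inr (Or.inl ⟨rfl, Or.inr ⟨τ, rfl, h1⟩⟩)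

lemma Gn_adj_inl_inr {T : Set (List ℕ)} {m : ℕ} {i : Fin 3}
    {σ : {σ : List ℕ // σ ∈ T ∧ σ ≠ []}} {y : ZMod (2 * m + 4)}
    (h : (Gn T m).Adj (Sum.inl i) (Sum.inr (σ, y))) : i = 0 ∧ σ.1.length = 1 ∧ y = 0 := by
  rcases (Gn_adj.1 h).2 with h | h
  · exact h
  · exact h.elim

/-- A closed walk without repeated vertices that starts at the entry vertex of a block and avoids
the vertex leading to that block stays in the block. -/
lemma cycle_stays_in_block {T : Set (List ℕ)} {m L : ℕ} {σ : {σ : List ℕ // σ ∈ T ∧ σ ≠ []}}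
    {d : ℕ → VG T m} (hinj : ∀ i < L, ∀ j < L, d i = d j → i = j)
    (hadj : ∀ i, (Gn T m).Adj (d i) (d (i + 1)))
    (h0 : d 0 = Sum.inr (σ, (0 : ZMod (2 * m + 4))))
    (hL : d L = d 0) {p : VG T m} (hp : ∀ i, d i ≠ p)
    (hpn : ∀ w, (Gn T m).Adj (Sum.inr (σ, (0 : ZMod (2 * m + 4)))) w →
      w = p ∨ ∃ y, w = Sum.inr (σ, y)) :
    ∀ i ≤ L, ∃ y, d i = Sum.inr (σ, y) := by
  intro i
  induction i with
  | zero => exact fun _ => ⟨_, h0⟩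
  | succ k ih =>
    intro hk
    obtain ⟨y, hy⟩ := ih (by omega)
    have hk' := hadj k
    rw [hy] at hk'
    rcases Gn_adj_inr hk' with ⟨y', h, -⟩ | ⟨rfl, -⟩ | ⟨rfl, τ, hτ, j, hj⟩
    · exact ⟨y', h⟩
    · rcases hpn _ hk' with h | h
      · exact absurd h (hp _)
      · exact h
    · exfalso
      have key : ∀ i, k + 1 ≤ i → i ≤ L →
          ∃ (ρ : {σ : List ℕ // σ ∈ T ∧ σ ≠ []}) (y : ZMod (2 * m + 4)),
            d i = Sum.inr (ρ, y) ∧ τ.1 <+: ρ.1 := by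
        intro i hi
        induction i, hi using Nat.le_induction with
        | base => exact fun _ => ⟨τ, 0, hτ, List.prefix_rfl⟩
        | succ i hi ih =>
          intro hiL
          obtain ⟨ρ, z, hz, hpre⟩ := ih (by omega)
          have hi' := hadj i
          rw [hz] at hi'
          rcases Gn_adj_inr hi' with ⟨y', h, -⟩ | ⟨rfl, ⟨h, hlen⟩ | ⟨ρ', h, j', hj'⟩⟩ |
            ⟨rfl, τ', h, j', hj'⟩
          · exact ⟨ρ, y', h, hpre⟩
          · have h1 := hpre.length_le
            have h2 := List.length_pos_of_ne_nil σ.2.2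
            rw [hj] at h1
            simp at h1
            omega
          · rw [hj', List.prefix_concat_iff] at hpre
            rcases hpre with hpre | hpre
            · rw [hj] at hpre
              have : ρ' = σ := Subtype.ext (List.append_inj' hpre rfl).1.symm
              subst this
              rcases Nat.lt_or_eq_of_le hiL with hlt | heq
              · have := hinj _ hlt _ (by omega) (h.trans hy.symm)
                omega
              · rw [heq, hL, h0] at h
                have h3 := congrArg Prod.snd (Sum.inr.inj h)
                exact absurd h3.symm (zmod_antipode_ne_zero m)
            · exact ⟨ρ', _, h, hpre⟩
          · exact ⟨τ', _, h, hpre.trans ⟨[j'], hj'.symm⟩⟩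
      obtain ⟨ρ, z, hz, hpre⟩ := key L hk le_rfl
      rw [hL, h0] at hz
      have h3 : σ = ρ := congrArg Prod.fst (Sum.inr.inj hz)
      have h4 := hpre.length_le
      rw [hj, ← h3] at h4
      simp at h4

/-- An injective cycle of length `2n+4` inside a cycle of length `2m+4` goes once around it. -/
lemma cycle_winds {m n : ℕ} {y : ℕ → ZMod (2 * m + 4)}
    (hinj : ∀ i < 2 * n + 4, ∀ j < 2 * n + 4, y i = y j → i = j)
    (h0 : y 0 = 0) (hL : y (2 * n + 4) = 0)
    (hstep : ∀ i < 2 * n + 4, y (i + 1) = y i + 1 ∨ y (i + 1) = y i - 1) :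
    m = n ∧ y (n + 2) = m + 2 ∧ ∀ z, ∃ i < 2 * n + 4, y i = z := by
  have hwind : ∃ ε : ZMod (2 * m + 4), (ε = 1 ∨ ε = -1) ∧
      ∀ i ≤ 2 * n + 4, y i = ε * i := by
    refine ⟨y 1, by simpa [h0] using hstep 0 (by omega), ?_⟩
    have hε : y 1 = 1 ∨ y 1 = -1 := by simpa [h0] using hstep 0 (by omega)
    have h2 : ∀ i, i + 1 ≤ 2 * n + 4 → y i = y 1 * i ∧ y (i + 1) = y 1 * (i + 1 : ℕ) := by
      intro i
      induction i with
      | zero => intro _; simp [h0]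
      | succ k ih =>
        intro hk
        obtain ⟨ha, hb⟩ := ih (by omega)
        refine ⟨hb, ?_⟩
        have hne : y (k + 1 + 1) ≠ y k := by
          intro h
          rcases Nat.lt_or_eq_of_le hk with hlt | heq
          · have := hinj _ hlt _ (by omega) h
            omega
          · rw [heq, hL, ← h0] at h
            have := hinj _ (by omega) _ (by omega) h
            omega
        have hs := hstep (k + 1) (by omega)
        push_cast at hb ⊢
        rcases hε with e | e <;> rw [e] at ha hb ⊢ <;> rcases hs with hs | hs
        · rw [hs, hb]; ring
        · exact absurd (by rw [hs, hb, ha]; ring) hne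
        · exact absurd (by rw [hs, hb, ha]; ring) hne
        · rw [hs, hb]; ring
    intro i hi
    rcases i with _ | i
    · simp [h0]
    · exact (h2 i hi).2
  obtain ⟨ε, hε, hy⟩ := hwind
  have hdvd : 2 * m + 4 ∣ 2 * n + 4 := by
    have h := hy _ le_rfl
    rw [hL] at h
    rw [← ZMod.natCast_eq_zero_iff]
    rcases hε with rfl | rfl
    · rw [h, one_mul]
    · rw [neg_one_mul] at h
      exact neg_eq_zero.mp h.symm
  have hinj' : Function.Injective (fun i : Fin (2 * n + 4) => y i) :=
    fun i j h => Fin.ext (hinj _ i.2 _ j.2 h)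
  have hle : 2 * n + 4 ≤ 2 * m + 4 := by
    simpa [ZMod.card] using Fintype.card_le_of_injective _ hinj'
  have hmn : m = n := by
    have := Nat.le_of_dvd (by omega) hdvd
    omega
  subst hmn
  refine ⟨rfl, ?_, fun z => ?_⟩
  · rw [hy _ (by omega)]
    rcases hε with rfl | rfl
    · push_cast; ring
    · push_cast
      rw [neg_one_mul, zmod_neg_antipode]
  · have hbij := (Fintype.bijective_iff_injective_and_card _).2
      ⟨hinj', by simp [ZMod.card]⟩
    obtain ⟨i, hi⟩ := hbij.2 z
    exact ⟨i, i.2, hi⟩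

/-- An injective image of a `(2n+4)`-cycle that starts at the entry vertex of a block of `G_T(m)`
and avoids the vertex leading to that block is the whole block, and then `m = n`. -/
lemma cycle_eq_block {T : Set (List ℕ)} {m n : ℕ} {σ : {σ : List ℕ // σ ∈ T ∧ σ ≠ []}}
    {c : ZMod (2 * n + 4) → VG T m} (hinj : Function.Injective c)
    (hadj : ∀ x, (Gn T m).Adj (c x) (c (x + 1)))
    (h0 : c 0 = Sum.inr (σ, (0 : ZMod (2 * m + 4)))) {p : VG T m} (hp : ∀ x, c x ≠ p)
    (hpn : ∀ w, (Gn T m).Adj (Sum.inr (σ, (0 : ZMod (2 * m + 4)))) w →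
      w = p ∨ ∃ y, w = Sum.inr (σ, y)) :
    m = n ∧ c (n + 2) = Sum.inr (σ, (m + 2 : ZMod (2 * m + 4))) ∧
      ∀ z, ∃ x, c x = Sum.inr (σ, z) := by
  have hdinj : ∀ i < 2 * n + 4, ∀ j < 2 * n + 4, c (i : ℕ) = c (j : ℕ) → i = j := by
    intro i hi j hj h
    have h1 := hinj h
    rw [ZMod.natCast_eq_natCast_iff'] at h1
    rwa [Nat.mod_eq_of_lt hi, Nat.mod_eq_of_lt hj] at h1
  have hdadj : ∀ i : ℕ, (Gn T m).Adj (c (i : ℕ)) (c ((i + 1 : ℕ))) := by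
    intro i
    simpa using hadj i
  have hdL : c ((2 * n + 4 : ℕ)) = c ((0 : ℕ)) := by
    rw [ZMod.natCast_self, Nat.cast_zero]
  have hd0 : c ((0 : ℕ)) = Sum.inr (σ, (0 : ZMod (2 * m + 4))) := by
    rw [Nat.cast_zero, h0]
  have hstay := cycle_stays_in_block (d := fun i : ℕ => c i) hdinj hdadj hd0 hdL
    (fun i => hp i) hpn
  have hex : ∀ i : ℕ, ∃ y : ZMod (2 * m + 4), i ≤ 2 * n + 4 → c i = Sum.inr (σ, y) := by
    intro i
    by_cases hi : i ≤ 2 * n + 4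
    · obtain ⟨y, hy⟩ := hstay i hi
      exact ⟨y, fun _ => hy⟩
    · exact ⟨0, fun h => absurd h hi⟩
  choose y hy using hex
  have hsnd : ∀ {a b : ZMod (2 * m + 4)},
      (Sum.inr (σ, a) : VG T m) = Sum.inr (σ, b) → a = b :=
    fun h => congrArg Prod.snd (Sum.inr.inj h)
  obtain ⟨hmn, hant, hsurj⟩ := cycle_winds (n := n) (y := y)
    (fun i hi j hj h => hdinj i hi j hj (by rw [hy i hi.le, hy j hj.le, h]))
    (hsnd ((hy 0 (by omega)).symm.trans hd0))
    (hsnd ((hy _ le_rfl).symm.trans (hdL.trans hd0)))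
    (fun i hi => by
      have h := hdadj i
      rw [hy i hi.le, hy (i + 1) hi] at h
      rcases (Gn_adj.1 h).2 with (⟨-, h⟩ | ⟨-, -, j, hj⟩) | (⟨-, h⟩ | ⟨-, -, j, hj⟩)
      · exact Or.inl h
      · simp at hj
      · exact Or.inr (by rw [h]; ring)
      · simp at hj)
  refine ⟨hmn, ?_, fun z => ?_⟩
  · have h := hy (n + 2) (by omega)
    rw [hant] at h
    push_cast at h
    exact h
  · obtain ⟨i, hi, rfl⟩ := hsurj z
    exact ⟨i, hy i hi.le⟩

/-- Block vertices of `G_T(m)` are properly coloured by the parity of their height. -/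
lemma Gn_block_coloring (T : Set (List ℕ)) (m : ℕ) :
    ∃ col : {σ : List ℕ // σ ∈ T ∧ σ ≠ []} × ZMod (2 * m + 4) → ZMod 2,
      ∀ a b, (Gn T m).Adj (Sum.inr a) (Sum.inr b) → col a ≠ col b := by
  let π : ZMod (2 * m + 4) →+* ZMod 2 := ZMod.castHom ⟨m + 2, by ring⟩ (ZMod 2)
  have h2 : (2 : ZMod 2) = 0 := rfl
  have hrel : ∀ a b : {σ : List ℕ // σ ∈ T ∧ σ ≠ []} × ZMod (2 * m + 4),
      relG T m (Sum.inr a) (Sum.inr b) →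
      π b.2 + (m + 1) * b.1.1.length = π a.2 + (m + 1) * a.1.1.length + 1 := by
    rintro ⟨σ, x⟩ ⟨τ, y⟩ (⟨rfl, rfl⟩ | ⟨rfl, rfl, j, hj⟩)
    · simp only [map_add, map_one]; ring
    · simp only [hj, map_add, map_natCast, map_ofNat, map_zero, List.length_append,
        List.length_singleton]
      push_cast
      linear_combination -h2
  refine ⟨fun a => π a.2 + (m + 1) * a.1.1.length, fun a b h hab => ?_⟩
  rcases (Gn_adj.1 h).2 with h | h
  · have := hrel a b h
    simp only at hab
    rw [hab] at this
    simp at this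
  · have := hrel b a h
    simp only at hab
    rw [hab] at this
    simp at this

/-- A triangle of `G_T(m)` contains no block vertex. -/
lemma Gn_triangle {T : Set (List ℕ)} {m : ℕ} {a b c : VG T m} (hab : (Gn T m).Adj a b)
    (hac : (Gn T m).Adj a c) (hbc : (Gn T m).Adj b c) : ∃ i, a = Sum.inl i := by
  obtain ⟨col, hcol⟩ := Gn_block_coloring T m
  have hzero : ∀ σ τ : {σ : List ℕ // σ ∈ T ∧ σ ≠ []},
      ¬ (Gn T m).Adj (Sum.inr (σ, (0 : ZMod (2 * m + 4))))
        (Sum.inr (τ, (0 : ZMod (2 * m + 4)))) := by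
    intro σ τ h
    have h1 := zmod_one_ne_zero m
    have h2 := zmod_antipode_ne_zero m
    rcases (Gn_adj.1 h).2 with (⟨-, h⟩ | ⟨h, -⟩) | (⟨-, h⟩ | ⟨h, -⟩)
    · rw [zero_add] at h; exact h1 h.symm
    · exact h2 h.symm
    · rw [zero_add] at h; exact h1 h.symm
    · exact h2 h.symm
  rcases a with i | ⟨σ, x⟩
  · exact ⟨i, rfl⟩
  exfalso
  rcases b with j | ⟨τ, y⟩
  · obtain ⟨rfl, -, rfl⟩ := Gn_adj_inl_inr hab.symm
    rcases c with k | ⟨ρ, z⟩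
    · obtain ⟨rfl, -⟩ := Gn_adj_inl_inr hac.symm
      exact hbc.ne rfl
    · obtain ⟨-, -, rfl⟩ := Gn_adj_inl_inr hbc
      exact hzero _ _ hac
  · rcases c with k | ⟨ρ, z⟩
    · obtain ⟨-, -, rfl⟩ := Gn_adj_inl_inr hac.symm
      obtain ⟨-, -, rfl⟩ := Gn_adj_inl_inr hbc.symm
      exact hzero _ _ hab
    · have h1 := hcol _ _ hab
      have h2 := hcol _ _ hac
      have h3 := hcol _ _ hbc
      generalize col (σ, x) = u at *
      generalize col (τ, y) = v at *
      generalize col (ρ, z) = w at *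
      revert u v w
      decide

lemma Hn_adj_inl {n : ℕ} {i j : Fin 3} (h : i ≠ j) :
    (Hn n).Adj (Sum.inl i) (Sum.inl j) := by
  rw [Hn, SimpleGraph.fromRel_adj]
  exact ⟨fun e => h (Sum.inl.inj e), Or.inl trivial⟩

lemma Hn_adj_entry (n : ℕ) : (Hn n).Adj (Sum.inl 0) (Sum.inr (0, 0)) := by
  rw [Hn, SimpleGraph.fromRel_adj]
  exact ⟨Sum.inl_ne_inr, Or.inl ⟨rfl, rfl, rfl⟩⟩

lemma Hn_adj_cycle (n k : ℕ) (x : ZMod (2 * n + 4)) :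
    (Hn n).Adj (Sum.inr (k, x)) (Sum.inr (k, x + 1)) := by
  rw [Hn, SimpleGraph.fromRel_adj]
  refine ⟨fun e => zmod_one_ne_zero n ?_, Or.inl (Or.inl ⟨rfl, rfl⟩)⟩
  have := congrArg Prod.snd (Sum.inr.inj e)
  simpa using this

lemma Hn_adj_bridge (n k : ℕ) :
    (Hn n).Adj (Sum.inr (k, (n + 2 : ZMod (2 * n + 4)))) (Sum.inr (k + 1, 0)) := by
  rw [Hn, SimpleGraph.fromRel_adj]
  refine ⟨fun e => ?_, Or.inl (Or.inr ⟨rfl, rfl, rfl⟩)⟩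
  have := congrArg Prod.fst (Sum.inr.inj e)
  simp at this

/-- `H_n` is connected: a function constant along edges is constant. -/
lemma Hn_constant {α : Type*} {n : ℕ} {g : Fin 3 ⊕ ℕ × ZMod (2 * n + 4) → α}
    (hg : ∀ u v, (Hn n).Adj u v → g u = g v) (v : Fin 3 ⊕ ℕ × ZMod (2 * n + 4)) :
    g v = g (Sum.inl 0) := by
  rcases v with i | ⟨k, x⟩
  · by_cases h : i = 0
    · rw [h]
    · exact hg _ _ (Hn_adj_inl h)
  · have hcyc : ∀ (k : ℕ) (x : ZMod (2 * n + 4)), g (Sum.inr (k, x)) = g (Sum.inr (k, 0)) := by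
      intro k x
      obtain ⟨i, rfl⟩ := ZMod.natCast_zmod_surjective x
      induction i with
      | zero => rw [Nat.cast_zero]
      | succ i ih => rw [← ih, Nat.cast_succ, hg _ _ (Hn_adj_cycle n k i)]
    rw [hcyc]
    clear x
    induction k with
    | zero => exact (hg _ _ (Hn_adj_entry n)).symm
    | succ k ih =>
      rw [← hg _ _ (Hn_adj_bridge n k), hcyc]
      exact ih

lemma GU_adj_fst {T : ℕ → Set (List ℕ)} {a b : VU T} (h : (GU T).Adj a b) : a.1 = b.1 := by
  rcases (GU_adj.1 h).2 with ⟨h, -⟩ | ⟨h, -⟩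
  · exact h
  · exact h.symm

lemma GU_adj_mk {T : ℕ → Set (List ℕ)} {m : ℕ} {a b : VG (T m) m} :
    (GU T).Adj ⟨m, a⟩ ⟨m, b⟩ ↔ (Gn (T m) m).Adj a b := by
  refine GU_adj.trans ⟨?_, ?_⟩
  · rintro ⟨-, ⟨_, h⟩ | ⟨_, h⟩⟩
    · exact h
    · exact h.symm
  · intro h
    refine ⟨fun e => h.ne (eq_of_heq (Sigma.mk.inj e).2), Or.inl ⟨rfl, h⟩⟩

/-- `ψ` maps the entry vertex of the block `D_k` to that of `C_σ`, and any neighbour of the latter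
outside `C_σ` is the image of a single vertex outside `D_k`. -/
def EntersBlock {T : Set (List ℕ)} {m n : ℕ} (ψ : Hn n →g Gn T m) (k : ℕ)
    (σ : {σ : List ℕ // σ ∈ T ∧ σ ≠ []}) : Prop :=
  ψ (Sum.inr (k, 0)) = Sum.inr (σ, (0 : ZMod (2 * m + 4))) ∧
  ∃ q, (∀ x, q ≠ Sum.inr (k, x)) ∧
    ∀ w, (Gn T m).Adj (Sum.inr (σ, (0 : ZMod (2 * m + 4)))) w →
      w = ψ q ∨ ∃ y, w = Sum.inr (σ, y)

lemma exists_entersBlock_zero {T : Set (List ℕ)} {m n : ℕ} {ψ : Hn n →g Gn T m}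
    (hψ : Function.Injective ψ) :
    ∃ σ : {σ : List ℕ // σ ∈ T ∧ σ ≠ []}, σ.1.length = 1 ∧ EntersBlock ψ 0 σ := by
  have htri : ∀ i : Fin 3, ∃ j : Fin 3, ψ (Sum.inl i) = Sum.inl j := by
    intro i
    exact Gn_triangle (ψ.map_rel (Hn_adj_inl (i := i) (j := i + 1) (by revert i; decide)))
      (ψ.map_rel (Hn_adj_inl (i := i) (j := i + 2) (by revert i; decide)))
      (ψ.map_rel (Hn_adj_inl (i := i + 1) (j := i + 2) (by revert i; decide)))
  choose t ht using htri
  have htinj : Function.Injective t := by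
    intro i j h
    exact Sum.inl.inj (hψ ((ht i).trans ((congrArg Sum.inl h).trans (ht j).symm)))
  have hadj := ψ.map_rel (Hn_adj_entry n)
  rw [ht 0] at hadj
  rcases hv : ψ (Sum.inr (0, 0)) with j | ⟨σ, y⟩
  · obtain ⟨i, hi⟩ := (Finite.injective_iff_surjective.1 htinj) j
    have : ψ (Sum.inr (0, 0)) = ψ (Sum.inl i) := by rw [hv, ht, hi]
    exact absurd (hψ this) Sum.inr_ne_inl
  · rw [hv] at hadj
    obtain ⟨h0, hlen, rfl⟩ := Gn_adj_inl_inr hadj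
    refine ⟨σ, hlen, hv, Sum.inl 0, fun x => Sum.inl_ne_inr, fun w hw => ?_⟩
    rcases Gn_adj_inr hw with ⟨y', h, -⟩ | ⟨-, ⟨h, -⟩ | ⟨ρ, -, j, hj⟩⟩ | ⟨h, -⟩
    · exact Or.inr ⟨y', h⟩
    · left
      rw [ht 0, h0, h]
    · have := List.length_pos_of_ne_nil ρ.2.2
      rw [hj, List.length_append, List.length_singleton] at hlen
      omega
    · exact absurd h.symm (zmod_antipode_ne_zero m)

lemma EntersBlock.next {T : Set (List ℕ)} {m n k : ℕ} {ψ : Hn n →g Gn T m}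
    (hψ : Function.Injective ψ) {σ : {σ : List ℕ // σ ∈ T ∧ σ ≠ []}} (h : EntersBlock ψ k σ) :
    m = n ∧ ∃ τ : {σ : List ℕ // σ ∈ T ∧ σ ≠ []},
      (∃ j, τ.1 = σ.1 ++ [j]) ∧ EntersBlock ψ (k + 1) τ := by
  obtain ⟨h0, q, hq, hqn⟩ := h
  obtain ⟨hmn, hant, hsurj⟩ := cycle_eq_block (c := fun x => ψ (Sum.inr (k, x)))
    (fun x y e => congrArg Prod.snd (Sum.inr.inj (hψ e)))
    (fun x => ψ.map_rel (Hn_adj_cycle n k x)) h0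
    (fun x e => hq x (hψ e).symm) hqn
  refine ⟨hmn, ?_⟩
  have hadj := ψ.map_rel (Hn_adj_bridge n k)
  rw [hant] at hadj
  rcases Gn_adj_inr hadj with ⟨y, hy, -⟩ | ⟨h, -⟩ | ⟨-, τ, hτ, j, hj⟩
  · obtain ⟨x, hx⟩ := hsurj y
    have := congrArg Prod.fst (Sum.inr.inj (hψ (hx.trans hy.symm)))
    simp at this
  · exact absurd h (zmod_antipode_ne_zero m)
  · refine ⟨τ, ⟨j, hj⟩, hτ, Sum.inr (k, (n + 2 : ZMod (2 * n + 4))), fun x e => ?_, fun w hw => ?_⟩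
    · have := congrArg Prod.fst (Sum.inr.inj e)
      simp at this
    · rcases Gn_adj_inr hw with ⟨y', h, -⟩ | ⟨-, ⟨-, hlen⟩ | ⟨ρ, h, j', hj'⟩⟩ | ⟨h, -⟩
      · exact Or.inr ⟨y', h⟩
      · have := List.length_pos_of_ne_nil σ.2.2
        rw [hj, List.length_append, List.length_singleton] at hlen
        omega
      · have : ρ = σ := Subtype.ext (List.append_inj' (hj'.symm.trans hj) rfl).1
        left
        rw [hant, h, this]
      · exact absurd h.symm (zmod_antipode_ne_zero m)

/-- An injective homomorphism from `H_n` to `G_T(m)` yields `m = n` and an infinite path. -/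
lemma exists_path_of_injective {T : Set (List ℕ)} (hT : IsTree T) {m n : ℕ} (ψ : Hn n →g Gn T m)
    (hψ : Function.Injective ψ) :
    m = n ∧ ∃ f : ℕ → ℕ, ∀ k : ℕ, (List.range k).map f ∈ T := by
  obtain ⟨σ₀, hlen, hσ₀⟩ := exists_entersBlock_zero hψ
  refine ⟨(hσ₀.next hψ).1, ?_⟩
  choose τ hτ hτ' using fun (k : ℕ) (σ : {σ // EntersBlock ψ k σ}) => (σ.2.next hψ).2
  choose j hj using hτ
  let s : ∀ k, {σ // EntersBlock ψ k σ} :=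
    fun k => Nat.rec ⟨σ₀, hσ₀⟩ (fun k σ => ⟨τ k σ, hτ' k σ⟩) k
  obtain ⟨a, ha⟩ := List.length_eq_one_iff.1 hlen
  let f : ℕ → ℕ := fun k => Nat.casesOn k a (fun k => j k (s k))
  have hf : ∀ k, (List.range (k + 1)).map f = (s k).1.1 := by
    intro k
    induction k with
    | zero => exact ha.symm
    | succ k ih =>
      rw [List.range_succ, List.map_append, ih]
      exact (hj k (s k)).symm
  refine ⟨f, fun k => hT (τ := (List.range (k + 1)).map f) ?_ ?_⟩
  · rw [hf]
    exact (s k).1.2.1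
  · rw [List.range_succ, List.map_append]
    exact List.prefix_append _ _

/-- An infinite path through `T` yields an injective homomorphism from `H_n` to `G_T(n)`. -/
lemma exists_injective_of_path {T : Set (List ℕ)} (n : ℕ) {f : ℕ → ℕ}
    (hf : ∀ k : ℕ, (List.range k).map f ∈ T) :
    ∃ ψ : Hn n →g Gn T n, Function.Injective ψ := by
  let s : ℕ → {σ : List ℕ // σ ∈ T ∧ σ ≠ []} :=
    fun k => ⟨(List.range (k + 1)).map f, hf _, by simp⟩
  have hs : Function.Injective s := by
    intro k l h
    have := congrArg (fun σ => σ.1.length) h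
    simpa [s] using this
  let g : Fin 3 ⊕ ℕ × ZMod (2 * n + 4) → VG T n := Sum.map id (Prod.map s id)
  have hg : Function.Injective g :=
    Sum.map_injective.2 ⟨Function.injective_id, hs.prodMap Function.injective_id⟩
  have hrel : ∀ u v, relH n u v → relG T n (g u) (g v) := by
    rintro (i | ⟨k, x⟩) (j | ⟨l, y⟩) h
    · trivial
    · obtain ⟨rfl, rfl, rfl⟩ := h
      exact ⟨rfl, by simp [s], rfl⟩
    · exact h.elim
    · rcases h with ⟨rfl, rfl⟩ | ⟨rfl, rfl, rfl⟩
      · exact Or.inl ⟨rfl, rfl⟩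
      · refine Or.inr ⟨rfl, rfl, f (k + 1), ?_⟩
        simp only [s]
        rw [List.range_succ, List.map_append]
        rfl
  refine ⟨⟨g, fun {u v} h => ?_⟩, hg⟩
  rw [Hn, SimpleGraph.fromRel_adj] at h
  exact Gn_adj.2 ⟨hg.ne h.1, h.2.imp (hrel _ _) (hrel _ _)⟩

theorem stmt13 (T : ℕ → Set (List ℕ)) (hT : ∀ m : ℕ, IsTree (T m)) (n : ℕ) :
    (∃ φ : Hn n →g GU T, Function.Injective φ) ↔
    ∃ f : ℕ → ℕ, ∀ k : ℕ, (List.range k).map f ∈ T n := by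
  constructor
  · rintro ⟨φ, hφ⟩
    have hex : ∀ v, ∃ w : VG (T (φ (Sum.inl 0)).1) (φ (Sum.inl 0)).1, φ v = ⟨_, w⟩ := by
      intro v
      have h := Hn_constant (g := fun v => (φ v).1) (fun u v h => GU_adj_fst (φ.map_rel h)) v
      rcases hv : φ v with ⟨m, w⟩
      rw [hv] at h
      simp only at h
      subst h
      exact ⟨w, rfl⟩
    generalize (φ (Sum.inl 0)).1 = m at hex
    choose ψ hψ using hex
    obtain ⟨rfl, h⟩ := exists_path_of_injective (hT m)
      (⟨ψ, fun {u v} h => GU_adj_mk.1 (by rw [← hψ, ← hψ]; exact φ.map_rel h)⟩ : Hn n →g Gn (T m) m)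
      (fun u v h => hφ (by rw [hψ, hψ]; exact congrArg _ h))
    exact h
  · rintro ⟨f, hf⟩
    obtain ⟨ψ, hψ⟩ := exists_injective_of_path n hf
    exact ⟨⟨fun v => ⟨n, ψ v⟩, fun h => GU_adj_mk.2 (ψ.map_rel h)⟩,
      fun u v h => hψ (eq_of_heq (Sigma.mk.inj h).2)⟩
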